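/- arXiv:1710.08507 — 2 statements merged into one kernel-verified Lean document; each statement's English description precedes it below -/
import Mathlib

section
/- For every positive integer n and every integer c, the number of partitions π ∈ EO* with |π| = n and eoc(π) = c equals the number of partitions π ∈ EO* with |π| = n and eoc(π) = −c. -/
/-- A partition is a finite multiset of positive integers. -/
def IsPartition (m : Multiset ℕ) : Prop := ∀ x ∈ m, 0 < x

/-- The largest even part of a partition (0 if there are no even parts). -/
def lep (m : Multiset ℕ) : ℕ := (m.filter (fun x => Even x)).sup

/-- `EO*`: every even part is smaller than every odd part, every part other than the
largest even part appears an even number of times, and the largest even part appears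
an odd number of times. -/
def EOStar (m : Multiset ℕ) : Prop :=
  IsPartition m ∧
  (∀ x ∈ m, ∀ y ∈ m, Even x → Odd y → x < y) ∧
  (∀ x ∈ m, x ≠ lep m → Even (m.count x)) ∧
  (∀ x ∈ m, x = lep m → Odd (m.count x))

/-- `E*`: partitions into even parts where each distinct part appears an even number of times. -/
def EStar (m : Multiset ℕ) : Prop :=
  IsPartition m ∧ (∀ x ∈ m, Even x) ∧ ∀ x : ℕ, Even (m.count x)

/-- `O_k*`: partitions into odd parts with exactly `2k` parts where each distinct part
appears an even number of times. -/
def OStar (k : ℕ) (m : Multiset ℕ) : Prop :=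
  IsPartition m ∧ (∀ x ∈ m, Odd x) ∧ Multiset.card m = 2 * k ∧ ∀ x : ℕ, Even (m.count x)

/-- `Q_{k,r}`: partitions with a `(k+r+1) × k` Durfee rectangle whose largest part below
the rectangle is `< k+r+1`; equivalently, exactly `k` parts are `≥ k+r+1`. -/
def QSet (k r : ℕ) (m : Multiset ℕ) : Prop :=
  IsPartition m ∧ Multiset.card (m.filter (fun x => k + r + 1 ≤ x)) = k

/-- `EO*_{k,r}`: partitions in `EO*` with exactly `2k` odd parts and largest even part `2k+2r`. -/
def EOkr (k r : ℕ) (m : Multiset ℕ) : Prop :=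
  EOStar m ∧ Multiset.card (m.filter (fun x => Odd x)) = 2 * k ∧ lep m = 2 * k + 2 * r

/-- The even-odd crank: largest even part minus the number of odd parts. -/
def eoc (m : Multiset ℕ) : ℤ :=
  (lep m : ℤ) - (Multiset.card (m.filter (fun x => Odd x)) : ℤ)

/-- The conjugate partition: its `i`-th part is the number of parts that are `≥ i`. -/
def conjugate (m : Multiset ℕ) : Multiset ℕ :=
  (Multiset.range m.sup).map (fun i => Multiset.card (m.filter (fun x => i + 1 ≤ x)))

/-- An overpartition: a partition together with a set of overlined part values, which must
be a subset of the distinct part values. -/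
def IsOverpartition (p : Multiset ℕ × Finset ℕ) : Prop :=
  IsPartition p.1 ∧ p.2 ⊆ p.1.toFinset

/-- The number of elements of `s` greater than `i`. -/
def tailCard (s : Multiset ℕ) (i : ℕ) : ℕ := s.countP (fun x => i < x)

/-- The conjugate of `s`, padded with zeros to exactly `b` parts. -/
def paddedConj (b : ℕ) (s : Multiset ℕ) : Multiset ℕ := (Multiset.range b).map (tailCard s)

lemma tailCard_antitone (s : Multiset ℕ) : Antitone (tailCard s) := by
  intro i j hij
  simp only [tailCard, Multiset.countP_eq_card_filter]
  exact Multiset.card_le_card (Multiset.monotone_filter_right s (fun x hx => lt_of_le_of_lt hij hx))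

lemma tailCard_eq_zero {s : Multiset ℕ} {b i : ℕ} (h : ∀ x ∈ s, x ≤ b) (hi : b ≤ i) :
    tailCard s i = 0 := by
  rw [tailCard, Multiset.countP_eq_zero]
  intro x hx
  have := h x hx
  omega

lemma count_succ_add_tailCard (s : Multiset ℕ) (i : ℕ) :
    s.count (i + 1) + tailCard s (i + 1) = tailCard s i := by
  induction s using Multiset.induction_on with
  | empty => simp [tailCard]
  | cons a s ih =>
    simp only [tailCard, Multiset.countP_cons, Multiset.count_cons] at ih ⊢
    split_ifs <;> omega

lemma count_zero_add_tailCard (s : Multiset ℕ) : s.count 0 + tailCard s 0 = s.card := by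
  induction s using Multiset.induction_on with
  | empty => simp [tailCard]
  | cons a s ih =>
    simp only [tailCard, Multiset.countP_cons, Multiset.count_cons, Multiset.card_cons] at ih ⊢
    split_ifs <;> omega

lemma eq_of_tailCard_eq {s t : Multiset ℕ} (h : ∀ i, tailCard s i = tailCard t i)
    (h0 : s.count 0 = t.count 0) : s = t := by
  ext x
  cases x with
  | zero => exact h0
  | succ i =>
    have h1 := count_succ_add_tailCard s i
    have h2 := count_succ_add_tailCard t i
    have h3 := h i
    have h4 := h (i + 1)
    omega

lemma lt_card_filter_range_iff {p : ℕ → Prop} [DecidablePred p]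
    (hp : ∀ i j, i ≤ j → p j → p i) {b : ℕ} (hb : ∀ i, p i → i < b) (i : ℕ) :
    i < ((Finset.range b).filter p).card ↔ p i := by
  constructor
  · intro h
    by_contra hn
    have hsub : (Finset.range b).filter p ⊆ Finset.range i := by
      intro j hj
      rw [Finset.mem_filter] at hj
      rw [Finset.mem_range]
      by_contra hji
      exact hn (hp i j (not_lt.mp hji) hj.2)
    have := Finset.card_le_card hsub
    rw [Finset.card_range] at this
    omega
  · intro h
    have hsub : Finset.range (i + 1) ⊆ (Finset.range b).filter p := by
      intro j hj
      rw [Finset.mem_range] at hj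
      have hpj := hp j i (by omega) h
      exact Finset.mem_filter.mpr ⟨Finset.mem_range.mpr (hb j hpj), hpj⟩
    have := Finset.card_le_card hsub
    rw [Finset.card_range] at this
    omega

lemma lt_tailCard_paddedConj_iff {s : Multiset ℕ} {b : ℕ} (h : ∀ x ∈ s, x ≤ b) (i j : ℕ) :
    i < tailCard (paddedConj b s) j ↔ j < tailCard s i := by
  have key : tailCard (paddedConj b s) j =
      ((Finset.range b).filter (fun i => j < tailCard s i)).card := by
    rw [tailCard, paddedConj, Multiset.countP_map]
    rfl
  rw [key]
  apply lt_card_filter_range_iff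
  · exact fun i i' hii hj => lt_of_lt_of_le hj (tailCard_antitone s hii)
  · intro i hi
    by_contra hb
    rw [tailCard_eq_zero h (not_lt.mp hb)] at hi
    omega

lemma tailCard_le_card (s : Multiset ℕ) (i : ℕ) : tailCard s i ≤ s.card :=
  Multiset.countP_le_card _ _

lemma le_card_of_mem_paddedConj {b : ℕ} {s : Multiset ℕ} {x : ℕ} (hx : x ∈ paddedConj b s) :
    x ≤ s.card := by
  obtain ⟨i, -, rfl⟩ := Multiset.mem_map.mp hx
  exact tailCard_le_card s i

lemma pos_of_mem_paddedConj_sup {s : Multiset ℕ} {x : ℕ} (hx : x ∈ paddedConj s.sup s) :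
    0 < x := by
  obtain ⟨i, hi, rfl⟩ := Multiset.mem_map.mp hx
  rw [Multiset.mem_range] at hi
  rw [tailCard, Multiset.countP_pos]
  by_contra! hn
  exact absurd (Multiset.sup_le.mpr hn) (not_le.mpr hi)

lemma card_paddedConj (b : ℕ) (s : Multiset ℕ) : (paddedConj b s).card = b := by
  simp [paddedConj]

lemma tailCard_paddedConj_paddedConj {s : Multiset ℕ} {b c : ℕ} (hb : ∀ x ∈ s, x ≤ b)
    (hc : ∀ x ∈ paddedConj b s, x ≤ c) (i : ℕ) :
    tailCard (paddedConj c (paddedConj b s)) i = tailCard s i := by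
  have h : ∀ j, j < tailCard (paddedConj c (paddedConj b s)) i ↔ j < tailCard s i := fun j => by
    rw [lt_tailCard_paddedConj_iff hc, lt_tailCard_paddedConj_iff hb]
  exact eq_of_forall_lt_iff h

lemma sum_paddedConj {s : Multiset ℕ} {b : ℕ} (h : ∀ x ∈ s, x ≤ b) :
    (paddedConj b s).sum = s.sum := by
  change ∑ i ∈ Finset.range b, tailCard s i = s.sum
  induction s using Multiset.induction_on with
  | empty => simp [tailCard]
  | cons a s ih =>
    have ha : a ≤ b := h a (Multiset.mem_cons_self a s)
    have hs := ih (fun x hx => h x (Multiset.mem_cons_of_mem hx))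
    simp only [tailCard, Multiset.countP_cons, Finset.sum_add_distrib, Multiset.sum_cons] at hs ⊢
    rw [hs, ← Finset.card_filter]
    have : (Finset.range b).filter (fun i => i < a) = Finset.range a := by
      ext i
      simp only [Finset.mem_filter, Finset.mem_range]
      omega
    rw [this, Finset.card_range, add_comm]

/-- Triples `(r, μ, ν)` with `μ` a partition into parts at most `r`; `ν` may contain zeros. -/
def IsCode (t : ℕ × Multiset ℕ × Multiset ℕ) : Prop := ∀ x ∈ t.2.1, 0 < x ∧ x ≤ t.1

/-- The even parts of the partition coded by `(r, μ, ν)`. -/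
def evenPart (r : ℕ) (μ : Multiset ℕ) : Multiset ℕ :=
  (if r = 0 then 0 else {2 * r}) + 2 • μ.map (fun x => 2 * x)

/-- The odd parts of the partition coded by `(r, μ, ν)`. -/
def oddPart (r : ℕ) (ν : Multiset ℕ) : Multiset ℕ := 2 • ν.map (fun x => 2 * r + 1 + 2 * x)

/-- The partition coded by `(r, μ, ν)`: its largest even part is `2 * r`. -/
def decode (t : ℕ × Multiset ℕ × Multiset ℕ) : Multiset ℕ :=
  evenPart t.1 t.2.1 + oddPart t.1 t.2.2

/-- The involution on codes which conjugates and exchanges the two partitions. -/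
def swapCode (t : ℕ × Multiset ℕ × Multiset ℕ) : ℕ × Multiset ℕ × Multiset ℕ :=
  (t.2.2.card, paddedConj t.2.2.sup t.2.2, paddedConj t.1 t.2.1)

lemma isCode_swapCode (t : ℕ × Multiset ℕ × Multiset ℕ) : IsCode (swapCode t) :=
  fun _ hx => ⟨pos_of_mem_paddedConj_sup hx, le_card_of_mem_paddedConj hx⟩

lemma swapCode_swapCode {t : ℕ × Multiset ℕ × Multiset ℕ} (ht : IsCode t) :
    swapCode (swapCode t) = t := by
  obtain ⟨r, μ, ν⟩ := t
  have hμ : ∀ x ∈ μ, x ≤ r := fun x hx => (ht x hx).2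
  refine Prod.ext (card_paddedConj r μ) (Prod.ext ?_ ?_)
  · refine eq_of_tailCard_eq
      (tailCard_paddedConj_paddedConj hμ (fun _ hx => Multiset.le_sup hx)) ?_
    rw [Multiset.count_eq_zero_of_notMem, Multiset.count_eq_zero_of_notMem]
    · exact fun h0 => absurd (ht 0 h0).1 (lt_irrefl 0)
    · exact fun h0 => absurd (pos_of_mem_paddedConj_sup h0) (lt_irrefl 0)
  · have h := tailCard_paddedConj_paddedConj (s := ν) (b := ν.sup) (c := ν.card)
      (fun _ hx => Multiset.le_sup hx) (fun _ hx => le_card_of_mem_paddedConj hx)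
    refine eq_of_tailCard_eq h ?_
    have h1 := count_zero_add_tailCard (paddedConj ν.card (paddedConj ν.sup ν))
    have h2 := count_zero_add_tailCard ν
    rw [card_paddedConj, h 0] at h1
    change Multiset.count 0 (paddedConj ν.card (paddedConj ν.sup ν)) = Multiset.count 0 ν
    omega

lemma even_of_mem_evenPart {r : ℕ} {μ : Multiset ℕ} {x : ℕ} (hx : x ∈ evenPart r μ) :
    Even x := by
  rw [evenPart, Multiset.mem_add] at hx
  rcases hx with hx | hx
  · split_ifs at hx
    · simp at hx
    · rw [Multiset.mem_singleton.mp hx]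
      exact even_two_mul r
  · obtain ⟨y, -, rfl⟩ := Multiset.mem_map.mp (Multiset.mem_of_mem_nsmul hx)
    exact even_two_mul y

lemma odd_of_mem_oddPart {r : ℕ} {ν : Multiset ℕ} {x : ℕ} (hx : x ∈ oddPart r ν) :
    Odd x ∧ 2 * r < x := by
  obtain ⟨y, -, rfl⟩ := Multiset.mem_map.mp (Multiset.mem_of_mem_nsmul hx)
  exact ⟨⟨r + y, by ring⟩, by omega⟩

lemma filter_even_decode (t : ℕ × Multiset ℕ × Multiset ℕ) :
    (decode t).filter (fun x => Even x) = evenPart t.1 t.2.1 := by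
  rw [decode, Multiset.filter_add, Multiset.filter_eq_self.mpr (fun _ => even_of_mem_evenPart),
    Multiset.filter_eq_nil.mpr
      (fun _ hx => Nat.not_even_iff_odd.mpr (odd_of_mem_oddPart hx).1), add_zero]

lemma filter_odd_decode (t : ℕ × Multiset ℕ × Multiset ℕ) :
    (decode t).filter (fun x => Odd x) = oddPart t.1 t.2.2 := by
  rw [decode, Multiset.filter_add,
    Multiset.filter_eq_self.mpr (fun _ hx => (odd_of_mem_oddPart hx).1),
    Multiset.filter_eq_nil.mpr
      (fun _ hx => Nat.not_odd_iff_even.mpr (even_of_mem_evenPart hx)), zero_add]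

lemma pos_and_le_of_mem_evenPart {r : ℕ} {μ : Multiset ℕ} (h : ∀ x ∈ μ, 0 < x ∧ x ≤ r) {x : ℕ}
    (hx : x ∈ evenPart r μ) : 0 < x ∧ x ≤ 2 * r := by
  rw [evenPart, Multiset.mem_add] at hx
  rcases hx with hx | hx
  · split_ifs at hx
    · simp at hx
    · rw [Multiset.mem_singleton.mp hx]
      omega
  · obtain ⟨y, hy, rfl⟩ := Multiset.mem_map.mp (Multiset.mem_of_mem_nsmul hx)
    have := h y hy
    omega

lemma lep_decode {t : ℕ × Multiset ℕ × Multiset ℕ} (ht : IsCode t) : lep (decode t) = 2 * t.1 := by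
  rw [lep, filter_even_decode]
  apply le_antisymm
  · exact Multiset.sup_le.mpr (fun x hx => (pos_and_le_of_mem_evenPart ht hx).2)
  · by_cases hr : t.1 = 0
    · simp [hr]
    · apply Multiset.le_sup
      simp [evenPart, hr]

lemma eoc_decode {t : ℕ × Multiset ℕ × Multiset ℕ} (ht : IsCode t) :
    eoc (decode t) = 2 * (t.1 : ℤ) - 2 * (t.2.2.card : ℤ) := by
  rw [eoc, lep_decode ht, filter_odd_decode, oddPart, Multiset.card_nsmul, Multiset.card_map]
  push_cast
  ring

lemma sum_decode (t : ℕ × Multiset ℕ × Multiset ℕ) :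
    (decode t).sum = 2 * (t.1 + t.2.2.card + 2 * t.1 * t.2.2.card + 2 * t.2.1.sum
      + 2 * t.2.2.sum) := by
  obtain ⟨r, μ, ν⟩ := t
  have h : (if r = 0 then (0 : Multiset ℕ) else {2 * r}).sum = 2 * r := by
    split_ifs with hr <;> simp [hr]
  have hmul : ∀ s : Multiset ℕ, (s.map (fun x => 2 * x)).sum = 2 * s.sum := fun s => by
    rw [Multiset.sum_map_mul_left, Multiset.map_id']
  simp only [decode, evenPart, oddPart, Multiset.sum_add, Multiset.sum_nsmul, h,
    hmul, Multiset.sum_map_add, Multiset.map_const', Multiset.sum_replicate, smul_eq_mul]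
  ring

lemma eoStar_decode {t : ℕ × Multiset ℕ × Multiset ℕ} (ht : IsCode t) : EOStar (decode t) := by
  have hcount : ∀ x, (decode t).count x =
      (if t.1 = 0 then 0 else if x = 2 * t.1 then 1 else 0) +
      2 * ((t.2.1.map (fun x => 2 * x)).count x
        + (t.2.2.map (fun x => 2 * t.1 + 1 + 2 * x)).count x) := by
    intro x
    rw [decode, evenPart, oddPart]
    simp only [Multiset.count_add, Multiset.count_nsmul]
    split_ifs with h1 h2
    · rw [Multiset.count_zero]
      ring
    · rw [h2, Multiset.count_singleton_self]
      ring
    · rw [Multiset.count_singleton, if_neg h2]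
      ring
  refine ⟨?_, ?_, ?_, ?_⟩
  · intro x hx
    rcases Multiset.mem_add.mp hx with hx | hx
    · exact (pos_and_le_of_mem_evenPart ht hx).1
    · have := (odd_of_mem_oddPart hx).2
      omega
  · intro x hx y hy hxe hyo
    have hx' := Multiset.mem_filter.mpr ⟨hx, hxe⟩
    have hy' := Multiset.mem_filter.mpr ⟨hy, hyo⟩
    rw [filter_even_decode] at hx'
    rw [filter_odd_decode] at hy'
    exact lt_of_le_of_lt (pos_and_le_of_mem_evenPart ht hx').2 (odd_of_mem_oddPart hy').2
  · intro x _ hxl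
    rw [lep_decode ht] at hxl
    rw [hcount, if_neg hxl, ite_self, zero_add]
    exact even_two_mul _
  · intro x hx hxl
    rw [lep_decode ht] at hxl
    have hr : t.1 ≠ 0 := by
      intro h0
      rcases Multiset.mem_add.mp hx with hx | hx
      · have := (pos_and_le_of_mem_evenPart ht hx).1
        omega
      · have := (odd_of_mem_oddPart hx).2
        omega
    rw [hcount, if_neg hr, if_pos hxl, add_comm]
    exact odd_two_mul_add_one _

lemma multiset_two_nsmul_injective : Function.Injective (fun s : Multiset ℕ => 2 • s) := by
  intro s t h
  ext x
  have := congrArg (Multiset.count x) h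
  simp only [Multiset.count_nsmul] at this
  omega

lemma decode_injOn : Set.InjOn decode {t | IsCode t} := by
  rintro ⟨r, μ, ν⟩ ht ⟨r', μ', ν'⟩ ht' h
  have hr : r = r' := by
    have h1 := lep_decode ht
    rw [h, lep_decode ht'] at h1
    simp only at h1
    omega
  subst hr
  have he := filter_even_decode (r, μ, ν)
  have ho := filter_odd_decode (r, μ, ν)
  rw [h, filter_even_decode] at he
  rw [h, filter_odd_decode] at ho
  have h1 := Multiset.map_injective (fun x y (hxy : 2 * r + 1 + 2 * x = 2 * r + 1 + 2 * y) => by omega)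
    (multiset_two_nsmul_injective ho)
  have h2 := Multiset.map_injective (fun x y (hxy : 2 * x = 2 * y) => by omega)
    (multiset_two_nsmul_injective (add_left_cancel he))
  exact Prod.ext rfl (Prod.ext h2.symm h1.symm)

lemma exists_two_nsmul_eq {s : Multiset ℕ} (h : ∀ x, Even (s.count x)) :
    ∃ t : Multiset ℕ, s = 2 • t := by
  refine ⟨∑ x ∈ s.toFinset, Multiset.replicate (s.count x / 2) x, ?_⟩
  ext y
  rw [Multiset.count_nsmul, Multiset.count_sum']
  simp only [Multiset.count_replicate]
  rw [Finset.sum_ite_eq' s.toFinset y]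
  obtain ⟨k, hk⟩ := h y
  split_ifs with hy
  · omega
  · rw [Multiset.mem_toFinset] at hy
    simp [hy]

lemma even_lep_and_mem (m : Multiset ℕ) :
    Even (lep m) ∧ (lep m ≠ 0 → lep m ∈ m) := by
  have key : ∀ s : Multiset ℕ, s.sup = 0 ∨ s.sup ∈ s := by
    intro s
    induction s using Multiset.induction_on with
    | empty => simp
    | cons a s ih =>
      rw [Multiset.sup_cons]
      rcases le_total a s.sup with h | h
      · rw [sup_eq_right.mpr h]
        exact ih.imp id Multiset.mem_cons_of_mem
      · rw [sup_eq_left.mpr h]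
        exact Or.inr (Multiset.mem_cons_self a s)
  rcases key (m.filter (fun x => Even x)) with h | h
  · change lep m = 0 at h
    simp [h]
  · exact ⟨(Multiset.mem_filter.mp h).2, fun _ => (Multiset.mem_filter.mp h).1⟩

lemma exists_decode_eq {m : Multiset ℕ} (hm : EOStar m) : ∃ t, IsCode t ∧ decode t = m := by
  obtain ⟨hpos, hlt, hne, heq⟩ := hm
  obtain ⟨hle, hmem⟩ := even_lep_and_mem m
  obtain ⟨r, hr⟩ := hle.two_dvd
  have hfodd : ∀ x, Even ((m.filter (fun x => Odd x)).count x) := by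
    intro x
    rw [Multiset.count_filter]
    split_ifs with hx
    · by_cases hxm : x ∈ m
      · refine hne x hxm ?_
        rintro rfl
        exact Nat.not_even_iff_odd.mpr hx hle
      · simp [hxm]
    · exact Even.zero
  have hfeven : ∀ x, Even (((m.filter (fun x => Even x)).erase (2 * r)).count x) := by
    intro x
    by_cases hxl : x = 2 * r
    · subst hxl
      rw [Multiset.count_erase_self, Multiset.count_filter, if_pos (even_two_mul r)]
      by_cases hxm : 2 * r ∈ m
      · obtain ⟨k, hk⟩ := heq _ hxm hr.symm
        exact ⟨k, by omega⟩
      · simp [hxm]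
    · rw [Multiset.count_erase_of_ne hxl, Multiset.count_filter]
      split_ifs with hx
      · by_cases hxm : x ∈ m
        · exact hne x hxm (by rwa [hr])
        · simp [hxm]
      · exact Even.zero
  obtain ⟨O, hO⟩ := exists_two_nsmul_eq hfodd
  obtain ⟨E, hE⟩ := exists_two_nsmul_eq hfeven
  have memO : ∀ x ∈ O, Odd x ∧ 2 * r < x := by
    intro x hx
    have hx' : x ∈ m.filter (fun x => Odd x) := by
      rw [hO]
      exact (Multiset.mem_nsmul.mpr ⟨two_ne_zero, hx⟩)
    obtain ⟨hxm, hxo⟩ := Multiset.mem_filter.mp hx'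
    refine ⟨hxo, ?_⟩
    by_cases h0 : lep m = 0
    · have := hpos x hxm
      omega
    · rw [← hr]
      exact hlt _ (hmem h0) x hxm hle hxo
  have memE : ∀ x ∈ E, Even x ∧ 0 < x ∧ x ≤ 2 * r := by
    intro x hx
    have hx' : x ∈ (m.filter (fun x => Even x)).erase (2 * r) := by
      rw [hE]
      exact (Multiset.mem_nsmul.mpr ⟨two_ne_zero, hx⟩)
    have hxf := Multiset.mem_of_mem_erase hx'
    obtain ⟨hxm, hxe⟩ := Multiset.mem_filter.mp hxf
    refine ⟨hxe, hpos x hxm, ?_⟩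
    rw [← hr]
    exact Multiset.le_sup hxf
  refine ⟨(r, E.map (fun x => x / 2), O.map (fun x => (x - 1) / 2 - r)), ?_, ?_⟩
  · intro x hx
    obtain ⟨y, hy, rfl⟩ := Multiset.mem_map.mp hx
    obtain ⟨⟨k, hk⟩, h1, h2⟩ := memE y hy
    dsimp only
    omega
  · have hEmap : (E.map (fun x => x / 2)).map (fun x => 2 * x) = E := by
      rw [Multiset.map_map]
      refine (Multiset.map_congr rfl (fun x hx => ?_)).trans (Multiset.map_id E)
      obtain ⟨⟨k, hk⟩, -⟩ := memE x hx
      simp only [Function.comp_apply, id]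
      omega
    have hOmap : (O.map (fun x => (x - 1) / 2 - r)).map (fun x => 2 * r + 1 + 2 * x) = O := by
      rw [Multiset.map_map]
      refine (Multiset.map_congr rfl (fun x hx => ?_)).trans (Multiset.map_id O)
      obtain ⟨⟨k, hk⟩, h⟩ := memO x hx
      simp only [Function.comp_apply, id]
      omega
    rw [decode, evenPart, oddPart]
    simp only [hEmap, hOmap]
    rw [← hE, ← hO]
    have heven : (if r = 0 then 0 else {2 * r}) + (m.filter (fun x => Even x)).erase (2 * r) =
        m.filter (fun x => Even x) := by
      split_ifs with h0
      · rw [zero_add, Multiset.erase_of_notMem]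
        intro h
        have := hpos _ (Multiset.mem_filter.mp h).1
        omega
      · rw [Multiset.singleton_add, Multiset.cons_erase]
        refine Multiset.mem_filter.mpr ⟨?_, even_two_mul r⟩
        rw [← hr]
        exact hmem (by omega)
    rw [heven]
    simp only [← Nat.not_even_iff_odd]
    exact Multiset.filter_add_not _ m

lemma eoStar_set_eq_image (n : ℕ) (c : ℤ) :
    {m : Multiset ℕ | EOStar m ∧ m.sum = n ∧ eoc m = c} =
      decode '' {t | IsCode t ∧ (decode t).sum = n ∧ eoc (decode t) = c} := by
  ext m
  constructor
  · rintro ⟨hm, hs⟩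
    obtain ⟨t, ht, rfl⟩ := exists_decode_eq hm
    exact ⟨t, ⟨ht, hs⟩, rfl⟩
  · rintro ⟨t, ⟨ht, hs⟩, rfl⟩
    exact ⟨eoStar_decode ht, hs⟩

lemma sum_decode_swapCode {t : ℕ × Multiset ℕ × Multiset ℕ} (ht : IsCode t) :
    (decode (swapCode t)).sum = (decode t).sum := by
  rw [sum_decode, sum_decode]
  simp only [swapCode, card_paddedConj]
  rw [sum_paddedConj (fun x hx => (ht x hx).2), sum_paddedConj (fun _ hx => Multiset.le_sup hx)]
  ring

lemma eoc_decode_swapCode {t : ℕ × Multiset ℕ × Multiset ℕ} (ht : IsCode t) :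
    eoc (decode (swapCode t)) = -eoc (decode t) := by
  rw [eoc_decode ht, eoc_decode (isCode_swapCode t)]
  simp only [swapCode, card_paddedConj]
  ring

/-- For every positive integer `n` and integer `c`, the number of partitions `π ∈ EO*` of
`n` with `eoc π = c` equals the number of those with `eoc π = -c`. -/
theorem stmt7 (n : ℕ) (hn : 0 < n) (c : ℤ) :
    {m : Multiset ℕ | EOStar m ∧ m.sum = n ∧ eoc m = c}.ncard =
    {m : Multiset ℕ | EOStar m ∧ m.sum = n ∧ eoc m = -c}.ncard := by
  rw [eoStar_set_eq_image, eoStar_set_eq_image,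
    Set.InjOn.ncard_image (decode_injOn.mono fun _ ht => ht.1),
    Set.InjOn.ncard_image (decode_injOn.mono fun _ ht => ht.1)]
  refine Set.ncard_congr (fun t _ => swapCode t) ?_ ?_ ?_
  · rintro t ⟨ht, hs, hc⟩
    exact ⟨isCode_swapCode t, by rw [sum_decode_swapCode ht, hs],
      by rw [eoc_decode_swapCode ht, hc]⟩
  · rintro t u ⟨ht, -⟩ ⟨hu, -⟩ h
    rw [← swapCode_swapCode ht, h, swapCode_swapCode hu]
  · rintro t ⟨ht, hs, hc⟩
    exact ⟨swapCode t, ⟨isCode_swapCode t, by rw [sum_decode_swapCode ht, hs],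
      by rw [eoc_decode_swapCode ht, hc, neg_neg]⟩, swapCode_swapCode ht⟩
end

section
/- For every positive integer n, eo₀(n) − eo₂(n) equals the number of pairs (α, δ) of partitions with |α| + |δ| = n, where α is a partition into distinct parts all divisible by 4 and δ is a partition into parts congruent to 4 modulo 8. -/
/-- The generating function, by sum of parts, of a class of multisets. -/
noncomputable def genSeries (C : Set (Multiset ℕ)) : PowerSeries ℤ :=
  PowerSeries.mk fun n => (({m | m ∈ C ∧ m.sum = n} : Set (Multiset ℕ)).ncard : ℤ)

/-- Partitions into parts from `S` in which every multiplicity is divisible by `d`. -/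
def multClass (d : ℕ) (S : Set ℕ) : Set (Multiset ℕ) :=
  {m | (∀ x ∈ m, 0 < x ∧ x ∈ S) ∧ ∀ x, d ∣ m.count x}

/-- Partitions into distinct parts from `S`. -/
def distinctClass (S : Set ℕ) : Set (Multiset ℕ) :=
  {m | (∀ x ∈ m, 0 < x ∧ x ∈ S) ∧ m.Nodup}

theorem zero_mem_multClass (d : ℕ) (S : Set ℕ) : 0 ∈ multClass d S :=
  ⟨by simp, by simp⟩

theorem zero_mem_distinctClass (S : Set ℕ) : 0 ∈ distinctClass S :=
  ⟨by simp, by simp⟩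

theorem finite_isPartition_sum (n : ℕ) : {m | IsPartition m ∧ m.sum = n}.Finite := by
  refine (Set.finite_range (fun p : n.Partition => p.parts)).subset ?_
  rintro m ⟨h, hs⟩
  exact ⟨⟨m, fun {i} hi => h i hi, hs⟩, rfl⟩

theorem finite_class_sum {C : Set (Multiset ℕ)} (hC : ∀ m ∈ C, IsPartition m) (n : ℕ) :
    {m | m ∈ C ∧ m.sum = n}.Finite :=
  (finite_isPartition_sum n).subset fun m hm => ⟨hC m hm.1, hm.2⟩

theorem genSeries_eq_add {C C₁ C₂ : Set (Multiset ℕ)} (t : Multiset ℕ)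
    (hC : ∀ m ∈ C, IsPartition m) (h : C = C₁ ∪ (t + ·) '' C₂)
    (hd : Disjoint C₁ ((t + ·) '' C₂)) :
    genSeries C = genSeries C₁ + PowerSeries.X ^ t.sum * genSeries C₂ := by
  ext n
  simp only [genSeries, map_add, PowerSeries.coeff_mk, PowerSeries.coeff_X_pow_mul']
  have hfin := finite_class_sum hC n
  have hu : {m | m ∈ C ∧ m.sum = n} =
      {m | m ∈ C₁ ∧ m.sum = n} ∪ {m | m ∈ (t + ·) '' C₂ ∧ m.sum = n} := by
    ext m
    simp only [h, Set.mem_union, Set.mem_ofPred_eq]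
    tauto
  have hdis : Disjoint {m | m ∈ C₁ ∧ m.sum = n} {m | m ∈ (t + ·) '' C₂ ∧ m.sum = n} :=
    hd.mono (fun m hm => hm.1) (fun m hm => hm.1)
  rw [hu] at hfin ⊢
  rw [Set.ncard_union_eq hdis (hfin.subset Set.subset_union_left)
    (hfin.subset Set.subset_union_right), Nat.cast_add]
  congr 1
  split_ifs with hn
  · have : {m | m ∈ (t + ·) '' C₂ ∧ m.sum = n} =
        (t + ·) '' {m | m ∈ C₂ ∧ m.sum = n - t.sum} := by
      ext m
      constructor
      · rintro ⟨⟨m', hm', rfl⟩, hs⟩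
        refine ⟨m', ⟨hm', ?_⟩, rfl⟩
        simp only [Multiset.sum_add] at hs
        omega
      · rintro ⟨m', ⟨hm', hs⟩, rfl⟩
        refine ⟨⟨m', hm', rfl⟩, ?_⟩
        simp only [Multiset.sum_add]
        omega
    rw [this, Set.ncard_image_of_injective _ (add_right_injective t)]
  · have : {m | m ∈ (t + ·) '' C₂ ∧ m.sum = n} = ∅ := by
      ext m
      simp only [Set.mem_ofPred_eq, Set.mem_empty_iff_false, iff_false]
      rintro ⟨⟨m', hm', rfl⟩, hs⟩
      simp only [Multiset.sum_add] at hs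
      omega
    rw [this]
    simp

theorem genSeries_multClass_mul {d k : ℕ} (hd : 0 < d) (hk : 0 < k) {S : Set ℕ} (hS : k ∈ S) :
    genSeries (multClass d S) * (1 - PowerSeries.X ^ (d * k)) =
      genSeries (multClass d (S \ {k})) := by
  have key := genSeries_eq_add (C := multClass d S) (C₁ := multClass d (S \ {k}))
    (C₂ := multClass d S) (Multiset.replicate d k) (fun m hm x hx => (hm.1 x hx).1) ?_ ?_
  · rw [Multiset.sum_replicate, smul_eq_mul] at key
    linear_combination key
  · ext m
    constructor
    · rintro ⟨h1, h2⟩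
      by_cases hkm : k ∈ m
      · right
        have hle : Multiset.replicate d k ≤ m :=
          Multiset.le_count_iff_replicate_le.1
            (Nat.le_of_dvd (Multiset.count_pos.2 hkm) (h2 k))
        obtain ⟨m', rfl⟩ := Multiset.le_iff_exists_add.1 hle
        refine ⟨m', ⟨fun x hx => h1 x (Multiset.mem_add.2 (Or.inr hx)), fun x => ?_⟩, rfl⟩
        have := h2 x
        rw [Multiset.count_add, Multiset.count_replicate] at this
        split_ifs at this
        · simpa using this
        · simpa using this
      · left
        exact ⟨fun x hx => ⟨(h1 x hx).1, (h1 x hx).2, fun hxk => hkm (hxk ▸ hx)⟩, h2⟩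
    · rintro (⟨h1, h2⟩ | ⟨m', ⟨h1, h2⟩, rfl⟩)
      · exact ⟨fun x hx => ⟨(h1 x hx).1, (h1 x hx).2.1⟩, h2⟩
      · refine ⟨fun x hx => ?_, fun x => ?_⟩
        · rcases Multiset.mem_add.1 hx with hx | hx
          · rw [Multiset.eq_of_mem_replicate hx]
            exact ⟨hk, hS⟩
          · exact h1 x hx
        · rw [Multiset.count_add, Multiset.count_replicate]
          refine dvd_add ?_ (h2 x)
          split_ifs <;> simp
  · rw [Set.disjoint_left]
    rintro m ⟨h1, -⟩ ⟨m', -, rfl⟩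
    exact (h1 k (Multiset.mem_add.2 (Or.inl (Multiset.mem_replicate.2 ⟨hd.ne', rfl⟩)))).2.2 rfl

theorem genSeries_distinctClass {k : ℕ} (hk : 0 < k) {S : Set ℕ} (hS : k ∈ S) :
    genSeries (distinctClass S) =
      genSeries (distinctClass (S \ {k})) * (1 + PowerSeries.X ^ k) := by
  have key := genSeries_eq_add (C := distinctClass S) (C₁ := distinctClass (S \ {k}))
    (C₂ := distinctClass (S \ {k})) {k} (fun m hm x hx => (hm.1 x hx).1) ?_ ?_
  · rw [Multiset.sum_singleton] at key
    linear_combination key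
  · ext m
    constructor
    · rintro ⟨h1, h2⟩
      by_cases hkm : k ∈ m
      · right
        obtain ⟨m', rfl⟩ := Multiset.exists_cons_of_mem hkm
        rw [Multiset.nodup_cons] at h2
        refine ⟨m', ⟨fun x hx => ?_, h2.2⟩, by simp⟩
        have := h1 x (Multiset.mem_cons_of_mem hx)
        exact ⟨this.1, this.2, fun hxk => h2.1 (hxk ▸ hx)⟩
      · left
        exact ⟨fun x hx => ⟨(h1 x hx).1, (h1 x hx).2, fun hxk => hkm (hxk ▸ hx)⟩, h2⟩
    · rintro (⟨h1, h2⟩ | ⟨m', ⟨h1, h2⟩, rfl⟩)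
      · exact ⟨fun x hx => ⟨(h1 x hx).1, (h1 x hx).2.1⟩, h2⟩
      · refine ⟨fun x hx => ?_, ?_⟩
        · rcases Multiset.mem_add.1 hx with hx | hx
          · rw [Multiset.mem_singleton.1 hx]
            exact ⟨hk, hS⟩
          · exact ⟨(h1 x hx).1, (h1 x hx).2.1⟩
        · simp only [Multiset.singleton_add, Multiset.nodup_cons]
          exact ⟨fun h => (h1 k h).2.2 rfl, h2⟩
  · rw [Set.disjoint_left]
    rintro m ⟨h1, -⟩ ⟨m', -, rfl⟩
    exact (h1 k (by simp)).2.2 rfl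

/-- A class containing the empty partition and otherwise only partitions with a part exceeding
`L` has generating function `1` modulo `X ^ (L + 1)`. -/
theorem X_pow_dvd_genSeries_sub_one {C : Set (Multiset ℕ)} {L : ℕ} (h0 : 0 ∈ C)
    (hC : ∀ m ∈ C, ∀ x ∈ m, L < x) :
    (PowerSeries.X : PowerSeries ℤ) ^ (L + 1) ∣ genSeries C - 1 := by
  rw [PowerSeries.X_pow_dvd_iff]
  intro n hn
  have hempty : ∀ m ∈ C, m.sum = n → m = 0 := by
    intro m hm hs
    refine Multiset.eq_zero_of_forall_notMem fun x hx => ?_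
    have h1 := hC m hm x hx
    have h2 := Multiset.le_sum_of_mem hx
    omega
  rw [map_sub, PowerSeries.coeff_one, genSeries, PowerSeries.coeff_mk]
  split_ifs with hz
  · subst hz
    have : {m | m ∈ C ∧ m.sum = 0} = {0} := by
      ext m
      constructor
      · rintro ⟨hm, hs⟩
        exact hempty m hm hs
      · rintro rfl
        exact ⟨h0, rfl⟩
    rw [this]
    simp
  · have : {m | m ∈ C ∧ m.sum = n} = ∅ := by
      ext m
      simp only [Set.mem_ofPred_eq, Set.mem_empty_iff_false, iff_false]
      rintro ⟨hm, hs⟩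
      rw [hempty m hm hs] at hs
      exact hz hs.symm
    rw [this]
    simp

theorem genSeries_multClass_mul_prod {d : ℕ} (hd : 0 < d) {S : Set ℕ} {k : ℕ → ℕ}
    (hpos : ∀ i, 0 < k i) (hk : Function.Injective k) (hS : ∀ i, k i ∈ S) (K : ℕ) :
    genSeries (multClass d S) * ∏ i ∈ Finset.range K, (1 - PowerSeries.X ^ (d * k i)) =
      genSeries (multClass d (S \ k '' Set.Iio K)) := by
  induction K with
  | zero => simp
  | succ K ih =>
    rw [Finset.prod_range_succ, ← mul_assoc, ih,
      genSeries_multClass_mul hd (hpos K) (S := S \ k '' Set.Iio K)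
        ⟨hS K, by simp [hk.eq_iff]⟩, Set.sdiff_sdiff,
      Set.Iio_add_one_eq_Iic, ← Set.Iio_insert, Set.image_insert_eq, Set.union_singleton]

theorem genSeries_distinctClass_eq_mul_prod {S : Set ℕ} {k : ℕ → ℕ}
    (hpos : ∀ i, 0 < k i) (hk : Function.Injective k) (hS : ∀ i, k i ∈ S) (K : ℕ) :
    genSeries (distinctClass S) = genSeries (distinctClass (S \ k '' Set.Iio K)) *
      ∏ i ∈ Finset.range K, (1 + PowerSeries.X ^ k i) := by
  induction K with
  | zero => simp
  | succ K ih =>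
    rw [Finset.prod_range_succ, ih,
      genSeries_distinctClass (hpos K) (S := S \ k '' Set.Iio K) ⟨hS K, by simp [hk.eq_iff]⟩,
      Set.sdiff_sdiff,
      Set.Iio_add_one_eq_Iic, ← Set.Iio_insert, Set.image_insert_eq, Set.union_singleton]
    ring

theorem coeff_genSeries_mul {A B : Set (Multiset ℕ)} (hA : ∀ m ∈ A, IsPartition m)
    (hB : ∀ m ∈ B, IsPartition m) (n : ℕ) :
    PowerSeries.coeff n (genSeries A * genSeries B) =
      (({p | p.1 ∈ A ∧ p.2 ∈ B ∧ p.1.sum + p.2.sum = n} :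
        Set (Multiset ℕ × Multiset ℕ)).ncard : ℤ) := by
  have hu : {p : Multiset ℕ × Multiset ℕ | p.1 ∈ A ∧ p.2 ∈ B ∧ p.1.sum + p.2.sum = n} =
      ⋃ a ∈ Finset.HasAntidiagonal.antidiagonal n,
        {m | m ∈ A ∧ m.sum = a.1} ×ˢ {m | m ∈ B ∧ m.sum = a.2} := by
    ext p
    simp only [Set.mem_ofPred_eq, Set.mem_iUnion, Set.mem_prod, Finset.HasAntidiagonal.mem_antidiagonal]
    constructor
    · rintro ⟨h1, h2, h3⟩
      exact ⟨(p.1.sum, p.2.sum), h3, ⟨h1, rfl⟩, h2, rfl⟩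
    · rintro ⟨a, ha, ⟨h1, h2⟩, h3, h4⟩
      exact ⟨h1, h3, by rw [h2, h4, ha]⟩
  rw [hu, ← Finset.set_biUnion_coe, Set.Finite.ncard_biUnion (Finset.finite_toSet _)
    (fun a _ => (finite_class_sum hA _).prod (finite_class_sum hB _)),
    finsum_mem_coe_finset, PowerSeries.coeff_mul, Nat.cast_sum]
  · refine Finset.sum_congr rfl fun a _ => ?_
    rw [Set.ncard_prod, Nat.cast_mul, genSeries, genSeries, PowerSeries.coeff_mk,
      PowerSeries.coeff_mk]
  · rintro a - b - hab
    rw [Function.onFun, Set.disjoint_left]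
    rintro p ⟨⟨-, h1⟩, -, h2⟩ ⟨⟨-, h3⟩, -, h4⟩
    exact hab (Prod.ext (h1.symm.trans h3) (h2.symm.trans h4))


/-- The `q`-binomial theorem specialised to `∑ (x²; x⁴)_N (-x²)^N / (x⁴; x⁴)_N`, over a ring in
which `x` is nilpotent. -/
theorem sum_mul_prod_eq_of_recurrence {R : Type*} [CommRing R] {x : R} {L : ℕ}
    (hx : x ^ (L + 1) = 0) {B : ℕ → R}
    (hB : ∀ N, B (N + 1) * (1 - x ^ (2 * (2 * N + 2))) = B N * (1 - x ^ (2 * (2 * N + 1)))) :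
    (∑ N ∈ Finset.range (L + 1), (-x ^ 2) ^ N * B N) *
        ∏ i ∈ Finset.range (L + 1), (1 + x ^ (4 * i + 2)) =
      (∏ i ∈ Finset.range (L + 1), (1 + x ^ (4 * i + 4))) * B 0 := by
  have hx' : ∀ m, L < m → x ^ m = 0 := fun m hm => pow_eq_zero_of_le hm hx
  have hstep : ∀ K, (∑ N ∈ Finset.range (L + 1), (-x ^ (4 * K + 2)) ^ N * B N) *
      (1 + x ^ (4 * K + 2)) = (1 + x ^ (4 * K + 4)) *
      ∑ N ∈ Finset.range (L + 1), (-x ^ (4 * (K + 1) + 2)) ^ N * B N := by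
    intro K
    have htel : ∀ M, (∑ N ∈ Finset.range M, (-x ^ (4 * K + 2)) ^ N * B N) *
        (1 + x ^ (4 * K + 2)) - (1 + x ^ (4 * K + 4)) *
        ∑ N ∈ Finset.range M, (-x ^ (4 * (K + 1) + 2)) ^ N * B N =
        - ((-x ^ (4 * K + 2)) ^ M * B M * (1 - x ^ (4 * M))) := by
      intro M
      induction M with
      | zero => simp
      | succ M ih =>
        rw [Finset.sum_range_succ, Finset.sum_range_succ]
        have h1 : (-x ^ (4 * (K + 1) + 2)) ^ M = (-x ^ (4 * K + 2)) ^ M * x ^ (4 * M) := by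
          rw [pow_mul x 4 M, ← mul_pow]
          ring
        rw [h1]
        linear_combination ih + (-x ^ (4 * K + 2)) ^ (M + 1) * hB M
    have h0 : (-x ^ (4 * K + 2)) ^ (L + 1) = 0 := by
      rw [neg_pow, ← pow_mul, hx' _ (by nlinarith), mul_zero]
    have := htel (L + 1)
    rw [h0] at this
    linear_combination this
  have hiter : ∀ K, (∑ N ∈ Finset.range (L + 1), (-x ^ 2) ^ N * B N) *
      ∏ i ∈ Finset.range K, (1 + x ^ (4 * i + 2)) =
      (∏ i ∈ Finset.range K, (1 + x ^ (4 * i + 4))) *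
        ∑ N ∈ Finset.range (L + 1), (-x ^ (4 * K + 2)) ^ N * B N := by
    intro K
    induction K with
    | zero => simp
    | succ K ih =>
      rw [Finset.prod_range_succ, Finset.prod_range_succ]
      linear_combination (1 + x ^ (4 * K + 2)) * ih +
        (∏ i ∈ Finset.range K, (1 + x ^ (4 * i + 4))) * hstep K
  rw [hiter (L + 1), Finset.sum_range_succ', hx' _ (by omega)]
  simp

/-- The values allowed as repeated parts of a partition in `EO*` with largest even part `2N`. -/
def evenOddSplit (N : ℕ) : Set ℕ := {k | Even k ∧ k ≤ 2 * N ∨ Odd k ∧ 2 * N < k}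

theorem genSeries_evenOddSplit_succ (N : ℕ) :
    genSeries (multClass 2 (evenOddSplit (N + 1))) *
        (1 - PowerSeries.X ^ (2 * (2 * N + 2))) =
      genSeries (multClass 2 (evenOddSplit N)) * (1 - PowerSeries.X ^ (2 * (2 * N + 1))) := by
  rw [genSeries_multClass_mul two_pos (by omega), genSeries_multClass_mul two_pos (by omega)]
  · congr 2
    ext k
    simp only [evenOddSplit, Set.mem_sdiff, Set.mem_ofPred_eq, Set.mem_singleton_iff,
      Nat.even_iff, Nat.odd_iff]
    omega
  · exact Or.inr ⟨by simp, by omega⟩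
  · exact Or.inl ⟨by simp [Nat.even_add], by omega⟩

theorem X_pow_dvd_eoStar_sum_sub (L : ℕ) :
    (PowerSeries.X : PowerSeries ℤ) ^ (L + 1) ∣
      (∑ N ∈ Finset.range (L + 1), (-PowerSeries.X ^ 2) ^ N *
        genSeries (multClass 2 (evenOddSplit N))) -
      genSeries (distinctClass {k | 4 ∣ k}) * genSeries (multClass 1 {k | k % 8 = 4}) := by
  set I := Ideal.span {(PowerSeries.X : PowerSeries ℤ) ^ (L + 1)} with hI
  set φ := Ideal.Quotient.mk I with hφ
  have hmem : ∀ {a b : PowerSeries ℤ}, φ a = φ b ↔ PowerSeries.X ^ (L + 1) ∣ a - b := by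
    intro a b
    rw [hφ, Ideal.Quotient.eq, hI, Ideal.mem_span_singleton]
  have hx : φ PowerSeries.X ^ (L + 1) = 0 := by
    rw [← map_pow, ← map_zero φ, hmem, sub_zero]
  have hone : ∀ {C : Set (Multiset ℕ)}, 0 ∈ C → (∀ m ∈ C, ∀ x ∈ m, L < x) →
      φ (genSeries C) = 1 := by
    intro C h0 hC
    rw [← map_one φ, hmem]
    exact X_pow_dvd_genSeries_sub_one h0 hC
  have hmain := sum_mul_prod_eq_of_recurrence hx
    (B := fun N => φ (genSeries (multClass 2 (evenOddSplit N)))) (fun N => by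
      simpa using congrArg φ (genSeries_evenOddSplit_succ N))
  have hodd := congrArg φ (genSeries_multClass_mul_prod two_pos (S := evenOddSplit 0)
    (k := fun i => 2 * i + 1) (fun i => by omega) (fun i j h => by simpa using h)
    (fun i => Or.inr ⟨by simp, by omega⟩) (L + 1))
  rw [hone (zero_mem_multClass _ _) ?_] at hodd
  swap
  · rintro m ⟨h, -⟩ x hx
    obtain ⟨hpos, h1 | ⟨h1, -⟩, h2⟩ := h x hx
    · omega
    · by_contra hlt
      obtain ⟨i, rfl⟩ := h1
      exact h2 ⟨i, by simp; omega, rfl⟩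
  have hfour := congrArg φ (genSeries_multClass_mul_prod one_pos (S := {k | k % 8 = 4})
    (k := fun i => 8 * i + 4) (fun i => by omega) (fun i j h => by simpa using h)
    (fun i => by simp) (L + 1))
  rw [hone (zero_mem_multClass _ _) ?_] at hfour
  swap
  · rintro m ⟨h, -⟩ x hx
    obtain ⟨hpos, h1, h2⟩ := h x hx
    by_contra hlt
    simp only [Set.mem_ofPred_eq] at h1
    exact h2 ⟨x / 8, by simp; omega, by simp; omega⟩
  have hdist := congrArg φ (genSeries_distinctClass_eq_mul_prod (S := {k | 4 ∣ k})
    (k := fun i => 4 * i + 4) (fun i => by omega) (fun i j h => by simpa using h)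
    (fun i => by simp) (L + 1))
  rw [map_mul, hone (zero_mem_distinctClass (_ \ _)) ?_, one_mul] at hdist
  swap
  · rintro m ⟨h, -⟩ x hx
    obtain ⟨hpos, ⟨j, rfl⟩, h2⟩ := h x hx
    by_contra hlt
    exact h2 ⟨j - 1, by simp; omega, by simp; omega⟩
  simp only [map_mul, map_prod, map_sub, map_add, map_one, map_pow] at hodd hfour hdist
  have hprod : (∏ i ∈ Finset.range (L + 1), (1 + φ PowerSeries.X ^ (4 * i + 2))) *
      ∏ i ∈ Finset.range (L + 1), (1 - φ PowerSeries.X ^ (2 * (2 * i + 1))) =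
      ∏ i ∈ Finset.range (L + 1), (1 - φ PowerSeries.X ^ (1 * (8 * i + 4))) := by
    rw [← Finset.prod_mul_distrib]
    exact Finset.prod_congr rfl fun i _ => by ring
  rw [← hmem]
  simp only [map_mul, map_sum, map_pow, map_neg, hdist]
  set f := ∑ N ∈ Finset.range (L + 1), (-φ PowerSeries.X ^ 2) ^ N *
    φ (genSeries (multClass 2 (evenOddSplit N)))
  set P := φ (genSeries (multClass 1 {k | k % 8 = 4}))
  set O := ∏ i ∈ Finset.range (L + 1), (1 - φ PowerSeries.X ^ (2 * (2 * i + 1)))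
  set D := ∏ i ∈ Finset.range (L + 1), (1 + φ PowerSeries.X ^ (4 * i + 4))
  linear_combination P * O * hmain - f * hfour + P * D * hodd - f * P * hprod

theorem lep_le_sum (m : Multiset ℕ) : lep m ≤ m.sum :=
  Multiset.sup_le.2 fun _ hx => Multiset.le_sum_of_mem (Multiset.mem_of_mem_filter hx)

theorem le_lep {m : Multiset ℕ} {x : ℕ} (hx : x ∈ m) (he : Even x) : x ≤ lep m :=
  Multiset.le_sup (Multiset.mem_filter.2 ⟨hx, he⟩)

theorem lep_mem {m : Multiset ℕ} (h : lep m ≠ 0) : lep m ∈ m := by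
  by_contra hmem
  have hsup : ∀ s : Multiset ℕ, s.sup ≠ 0 → s.sup ∈ s := by
    intro s
    induction s using Multiset.induction with
    | empty => simp
    | cons a s ih =>
      rw [Multiset.sup_cons]
      intro hs
      rcases le_total a s.sup with hle | hle
      · rw [sup_eq_right.2 hle] at hs ⊢
        exact Multiset.mem_cons_of_mem (ih hs)
      · rw [sup_eq_left.2 hle]
        exact Multiset.mem_cons_self a s
  exact hmem (Multiset.mem_of_mem_filter (hsup _ h))

theorem even_lep (m : Multiset ℕ) : Even (lep m) := by
  have hsup : ∀ s : Multiset ℕ, (∀ x ∈ s, Even x) → Even s.sup := by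
    intro s
    induction s using Multiset.induction with
    | empty => simp
    | cons a s ih =>
      intro hs
      rw [Multiset.sup_cons]
      rcases le_total a s.sup with hle | hle
      · rw [sup_eq_right.2 hle]
        exact ih fun x hx => hs x (Multiset.mem_cons_of_mem hx)
      · rw [sup_eq_left.2 hle]
        exact hs a (Multiset.mem_cons_self a s)
  exact hsup _ fun x hx => (Multiset.mem_filter.1 hx).2

theorem lep_eq {m : Multiset ℕ} {k : ℕ} (hk : Even k) (hmem : k ∈ m)
    (hle : ∀ x ∈ m, Even x → x ≤ k) : lep m = k :=
  le_antisymm (Multiset.sup_le.2 fun x hx =>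
    hle x (Multiset.mem_filter.1 hx).1 (Multiset.mem_filter.1 hx).2) (le_lep hmem hk)

theorem setOf_eoStar_lep_eq_zero :
    {m | EOStar m ∧ lep m = 0} = multClass 2 (evenOddSplit 0) := by
  ext m
  constructor
  · rintro ⟨⟨h1, h2, h3, h4⟩, hl⟩
    refine ⟨fun x hx => ⟨h1 x hx, ?_⟩, fun x => ?_⟩
    · rcases Nat.even_or_odd x with he | ho
      · exact Or.inl ⟨he, (le_lep hx he).trans hl.le⟩
      · exact Or.inr ⟨ho, by simpa using h1 x hx⟩
    · by_cases hx : x ∈ m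
      · exact (h3 x hx (by have := h1 x hx; omega)).two_dvd
      · simp [hx]
  · rintro ⟨h1, h2⟩
    have hodd : ∀ x ∈ m, Odd x := by
      intro x hx
      obtain ⟨hpos, ⟨-, h⟩ | ⟨h, -⟩⟩ := h1 x hx
      · omega
      · exact h
    have hl : lep m = 0 := by
      by_contra h
      exact Nat.not_even_iff_odd.2 (hodd _ (lep_mem h)) (even_lep m)
    refine ⟨⟨fun x hx => (h1 x hx).1, fun x hx y _ he => ?_, fun x _ _ => ?_, fun x hx hxl => ?_⟩,
      hl⟩
    · exact absurd he (Nat.not_even_iff_odd.2 (hodd x hx))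
    · exact even_iff_two_dvd.2 (h2 x)
    · have := (h1 x hx).1
      omega

theorem setOf_eoStar_lep_eq {N : ℕ} (hN : 0 < N) :
    {m | EOStar m ∧ lep m = 2 * N} =
      (({2 * N} : Multiset ℕ) + ·) '' multClass 2 (evenOddSplit N) := by
  ext m
  constructor
  · rintro ⟨⟨h1, h2, h3, h4⟩, hl⟩
    have hmem : 2 * N ∈ m := hl ▸ lep_mem (by omega)
    have hsplit : ∀ x ∈ m, x ∈ evenOddSplit N := by
      intro x hx
      rcases Nat.even_or_odd x with he | ho
      · exact Or.inl ⟨he, (le_lep hx he).trans hl.le⟩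
      · exact Or.inr ⟨ho, h2 _ hmem x hx (even_two_mul N) ho⟩
    obtain ⟨m', rfl⟩ := Multiset.exists_cons_of_mem hmem
    refine ⟨m', ⟨fun x hx => ?_, fun x => ?_⟩, by simp⟩
    · exact ⟨h1 x (Multiset.mem_cons_of_mem hx), hsplit x (Multiset.mem_cons_of_mem hx)⟩
    · rw [← even_iff_two_dvd]
      by_cases hx : x = 2 * N
      · have := h4 (2 * N) hmem hl.symm
        rw [Multiset.count_cons_self] at this
        rw [hx]
        exact (Nat.odd_add_one.1 this |> Nat.not_odd_iff_even.1)
      · by_cases hxm : x ∈ m'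
        · have := h3 x (Multiset.mem_cons_of_mem hxm) (by rwa [hl])
          rwa [Multiset.count_cons_of_ne hx] at this
        · simp [hxm]
  · rintro ⟨m', ⟨h1, h2⟩, rfl⟩
    simp only [Multiset.singleton_add]
    have hl : lep (2 * N ::ₘ m') = 2 * N := by
      refine lep_eq (even_two_mul N) (Multiset.mem_cons_self _ _) fun x hx he => ?_
      rcases Multiset.mem_cons.1 hx with rfl | hx
      · exact le_rfl
      · obtain ⟨-, ⟨-, h⟩ | ⟨h, -⟩⟩ := h1 x hx
        · exact h
        · exact absurd he (Nat.not_even_iff_odd.2 h)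
    refine ⟨⟨fun x hx => ?_, fun x hx y hy he ho => ?_, fun x _ hxl => ?_, fun x _ hxl => ?_⟩, hl⟩
    · rcases Multiset.mem_cons.1 hx with rfl | hx
      · omega
      · exact (h1 x hx).1
    · have hxle := le_lep hx he
      rw [hl] at hxle
      rcases Multiset.mem_cons.1 hy with rfl | hy
      · exact absurd (even_two_mul N) (Nat.not_even_iff_odd.2 ho)
      · obtain ⟨-, ⟨h, -⟩ | ⟨-, h⟩⟩ := h1 y hy
        · exact absurd h (Nat.not_even_iff_odd.2 ho)
        · omega
    · rw [hl] at hxl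
      rw [Multiset.count_cons_of_ne hxl]
      exact even_iff_two_dvd.2 (h2 x)
    · rw [hl] at hxl
      rw [hxl, Multiset.count_cons_self]
      exact (even_iff_two_dvd.2 (h2 _)).add_one

theorem genSeries_eoStar_lep (N : ℕ) :
    genSeries {m | EOStar m ∧ lep m = 2 * N} =
      PowerSeries.X ^ (2 * N) * genSeries (multClass 2 (evenOddSplit N)) := by
  rcases Nat.eq_zero_or_pos N with rfl | hN
  · rw [mul_zero, setOf_eoStar_lep_eq_zero, pow_zero, one_mul]
  · have h := genSeries_eq_add (C := {m | EOStar m ∧ lep m = 2 * N}) (C₁ := ∅)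
      (C₂ := multClass 2 (evenOddSplit N)) {2 * N} (fun m hm => hm.1.1)
      (by rw [setOf_eoStar_lep_eq hN, Set.empty_union]) (Set.empty_disjoint _)
    have h0 : genSeries ∅ = 0 := by
      ext n
      simp [genSeries]
    rwa [h0, zero_add, Multiset.sum_singleton] at h

theorem ncard_eoStar_sub (n : ℕ) :
    ({m : Multiset ℕ | EOStar m ∧ m.sum = n ∧ lep m % 4 = 0}.ncard : ℤ) -
    ({m : Multiset ℕ | EOStar m ∧ m.sum = n ∧ lep m % 4 = 2}.ncard : ℤ) =
    ∑ N ∈ Finset.range (n + 1),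
      (-1) ^ N * PowerSeries.coeff n (genSeries {m | EOStar m ∧ lep m = 2 * N}) := by
  classical
  have hfin : {m | EOStar m ∧ m.sum = n}.Finite :=
    (finite_isPartition_sum n).subset fun m hm => ⟨hm.1.1, hm.2⟩
  have hcard : ∀ (p : Multiset ℕ → Prop) [DecidablePred p],
      (({m | EOStar m ∧ m.sum = n ∧ p m} : Set (Multiset ℕ)).ncard : ℤ) =
        ∑ m ∈ hfin.toFinset, if p m then 1 else 0 := by
    intro p _
    rw [Finset.sum_boole, ← Set.ncard_coe_finset]
    congr 2
    ext m
    simp [and_assoc]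
  rw [hcard, hcard, ← Finset.sum_sub_distrib]
  have hcoeff : ∀ N, PowerSeries.coeff n (genSeries {m | EOStar m ∧ lep m = 2 * N}) =
      ∑ m ∈ hfin.toFinset, if lep m = 2 * N then 1 else 0 := by
    intro N
    rw [← hcard fun m => lep m = 2 * N, genSeries, PowerSeries.coeff_mk]
    congr 2
    ext m
    simp only [Set.mem_ofPred_eq]
    tauto
  simp only [hcoeff, Finset.mul_sum]
  rw [Finset.sum_comm]
  refine Finset.sum_congr rfl fun m hm => ?_
  obtain ⟨N, hN⟩ := (even_lep m).two_dvd
  have hle := lep_le_sum m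
  have hsum : m.sum = n := ((Set.Finite.mem_toFinset hfin).1 hm).2
  rw [Finset.sum_eq_single N]
  · rw [hN]
    rcases Nat.even_or_odd N with he | ho
    · have h4 : 2 * N % 4 = 0 := by
        obtain ⟨j, rfl⟩ := he
        omega
      simp [h4, he.neg_one_pow]
    · have h4 : 2 * N % 4 = 2 := by
        obtain ⟨j, rfl⟩ := ho
        omega
      simp [h4, ho.neg_one_pow]
  · intro b _ hb
    rw [if_neg (by omega), mul_zero]
  · intro hnot
    exact absurd (Finset.mem_range.2 (by omega)) hnot

/-- For every positive integer `n`, `eo₀(n) - eo₂(n)` equals the number of pairs `(α, δ)`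
with `|α| + |δ| = n`, where `α` has distinct parts all divisible by `4` and all parts of `δ`
are `≡ 4 (mod 8)`. -/
theorem stmt8 (n : ℕ) (hn : 0 < n) :
    ({m : Multiset ℕ | EOStar m ∧ m.sum = n ∧ lep m % 4 = 0}.ncard : ℤ) -
    ({m : Multiset ℕ | EOStar m ∧ m.sum = n ∧ lep m % 4 = 2}.ncard : ℤ) =
    ({p : Multiset ℕ × Multiset ℕ |
      IsPartition p.1 ∧ p.1.Nodup ∧ (∀ x ∈ p.1, 4 ∣ x) ∧
      (∀ x ∈ p.2, x % 8 = 4) ∧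
      p.1.sum + p.2.sum = n}.ncard : ℤ) := by
  have hrhs := coeff_genSeries_mul (A := distinctClass {k | 4 ∣ k})
    (B := multClass 1 {k | k % 8 = 4}) (fun m hm x hx => (hm.1 x hx).1)
    (fun m hm x hx => (hm.1 x hx).1) n
  have hset : {p : Multiset ℕ × Multiset ℕ | IsPartition p.1 ∧ p.1.Nodup ∧
      (∀ x ∈ p.1, 4 ∣ x) ∧ (∀ x ∈ p.2, x % 8 = 4) ∧ p.1.sum + p.2.sum = n} =
      {p | p.1 ∈ distinctClass {k | 4 ∣ k} ∧ p.2 ∈ multClass 1 {k | k % 8 = 4} ∧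
        p.1.sum + p.2.sum = n} := by
    ext p
    constructor
    · rintro ⟨h1, h2, h3, h4, h5⟩
      exact ⟨⟨fun x hx => ⟨h1 x hx, h3 x hx⟩, h2⟩,
        ⟨fun x hx => ⟨by have := h4 x hx; omega, h4 x hx⟩, fun x => one_dvd _⟩, h5⟩
    · rintro ⟨⟨h1, h2⟩, ⟨h3, -⟩, h5⟩
      exact ⟨fun x hx => (h1 x hx).1, h2, fun x hx => (h1 x hx).2, fun x hx => (h3 x hx).2, h5⟩
  have hcongr := PowerSeries.X_pow_dvd_iff.1 (X_pow_dvd_eoStar_sum_sub n) n (Nat.lt_succ_self n)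
  rw [map_sub, sub_eq_zero, map_sum] at hcongr
  rw [hset, ← hrhs, ← hcongr, ncard_eoStar_sub]
  refine Finset.sum_congr rfl fun N _ => ?_
  rw [genSeries_eoStar_lep, neg_pow (PowerSeries.X ^ 2 : PowerSeries ℤ), ← pow_mul, mul_assoc]
  rcases Nat.even_or_odd N with h | h <;> simp [h.neg_one_pow]
end
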